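/- The set B = {φ₁+φ₂+2φ₃, φ₁+φ₂+φ₃+φ₄, −(φ₁+φ₂+φ₃), φ₂} is a base of Δ, and the positive system determined by B equals Δ_k⁺ ∪ {β ∈ Δ_n⁺ : β ≥ φ₁+φ₂+2φ₃ or β ≥ φ₁+φ₂+φ₃+φ₄} ∪ (−{β ∈ Δ_n⁺ : β ≤ φ₁+φ₂+φ₃}); in particular this positive system contains Δ_k⁺. -/

import Mathlib

noncomputable section

abbrev V : Type := Fin 4 → ℝ

def e (i : Fin 4) : V := Pi.single i 1

/-- The root system of type F₄ in ℝ⁴ (48 vectors). -/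
def Δ : Set V :=
  (⋃ i, ({e i, -e i} : Set V)) ∪
  (⋃ (i) (j) (_ : i < j), ({e i + e j, e i - e j, -e i + e j, -e i - e j} : Set V)) ∪
  {v | ∃ s : Fin 4 → ℝ, (∀ i, s i = 1 ∨ s i = -1) ∧ v = (1 / 2 : ℝ) • ∑ i, s i • e i}

def φ₁ : V := e 1 - e 2
def φ₂ : V := e 2 - e 3
def φ₃ : V := e 3
def φ₄ : V := (1 / 2 : ℝ) • (e 0 - e 1 - e 2 - e 3)

def φv : Fin 4 → V := ![φ₁, φ₂, φ₃, φ₄]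

/-- The coordinates `n₁(α), …, n₄(α)` of `α` with respect to the basis φ₁,…,φ₄:
for every `α : V` one has `α = ∑ i, n α i • φv i`. -/
def n (α : V) : Fin 4 → ℝ :=
  ![α 1 + α 0, α 1 + α 2 + 2 * α 0, α 1 + α 2 + α 3 + 3 * α 0, 2 * α 0]

/-- The highest root δ = 2φ₁+3φ₂+4φ₃+2φ₄ = e₁+e₂. -/
def δ : V := e 0 + e 1

/-- Compact roots: roots α with n₁(α) even. -/
def Δk : Set V := {α ∈ Δ | ∃ m : ℤ, n α 0 = 2 * m}

/-- Noncompact roots: roots α with n₁(α) odd. -/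
def Δn : Set V := {α ∈ Δ | ∃ m : ℤ, n α 0 = 2 * m + 1}

/-- Δ⁺: roots with all φ-coefficients nonnegative. -/
def Δp : Set V := {α ∈ Δ | ∀ i, 0 ≤ n α i}

def Δkp : Set V := Δp ∩ Δk
def Δnp : Set V := Δp ∩ Δn

/-- A positive system of Δ: the set of roots on which some root-regular linear
functional is positive. -/
def IsPosSystem (P : Set V) : Prop :=
  ∃ f : V →ₗ[ℝ] ℝ, (∀ α ∈ Δ, f α ≠ 0) ∧ P = {α ∈ Δ | 0 < f α}

/-- `le' γ β` means γ ≤ β, i.e. β − γ is a nonnegative integer combination of φ₁,…,φ₄. -/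
def le' (γ β : V) : Prop := ∃ c : Fin 4 → ℕ, β - γ = ∑ i, (c i : ℝ) • φv i

/-- A base of Δ: a linearly independent subset of Δ such that every root is an
integral combination with coefficients all ≥ 0 or all ≤ 0. -/
def IsBase (B : Finset V) : Prop :=
  ↑B ⊆ Δ ∧ LinearIndependent ℝ (Subtype.val : {x : V // x ∈ B} → V) ∧
  ∀ α ∈ Δ, ∃ c : V → ℤ,
    α = ∑ x ∈ B, (c x : ℝ) • x ∧ ((∀ x ∈ B, 0 ≤ c x) ∨ (∀ x ∈ B, c x ≤ 0))

/-- The positive system determined by a base B: roots whose B-coefficients are all ≥ 0. -/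
def posOf (B : Finset V) : Set V :=
  {α ∈ Δ | ∃ c : V → ℤ, α = ∑ x ∈ B, (c x : ℝ) • x ∧ ∀ x ∈ B, 0 ≤ c x}

/-- The vector with integer coordinates `m` with respect to `φ₁, …, φ₄`. -/
def ofCoords (m : Fin 4 → ℤ) : V := ∑ i, (m i : ℝ) • φv i

theorem ofCoords_apply_zero (m : Fin 4 → ℤ) : ofCoords m 0 = m 3 / 2 := by
  simp [ofCoords, φv, φ₁, φ₂, φ₃, φ₄, e, Fin.sum_univ_four]
  ring

theorem ofCoords_apply_one (m : Fin 4 → ℤ) : ofCoords m 1 = m 0 - m 3 / 2 := by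
  simp [ofCoords, φv, φ₁, φ₂, φ₃, φ₄, e, Fin.sum_univ_four]
  ring

theorem ofCoords_apply_two (m : Fin 4 → ℤ) : ofCoords m 2 = m 1 - m 0 - m 3 / 2 := by
  simp [ofCoords, φv, φ₁, φ₂, φ₃, φ₄, e, Fin.sum_univ_four]
  ring

theorem ofCoords_apply_three (m : Fin 4 → ℤ) : ofCoords m 3 = m 2 - m 1 - m 3 / 2 := by
  simp [ofCoords, φv, φ₁, φ₂, φ₃, φ₄, e, Fin.sum_univ_four]
  ring

theorem n_ofCoords (m : Fin 4 → ℤ) (i : Fin 4) : n (ofCoords m) i = m i := by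
  fin_cases i <;>
    simp [n, ofCoords_apply_zero, ofCoords_apply_one, ofCoords_apply_two,
      ofCoords_apply_three] <;> ring

theorem ofCoords_injective : Function.Injective ofCoords := fun m m' h ↦ by
  ext i
  exact_mod_cast (n_ofCoords m i).symm.trans ((congrArg (n · i) h).trans (n_ofCoords m' i))

theorem ofCoords_add (m m' : Fin 4 → ℤ) : ofCoords (m + m') = ofCoords m + ofCoords m' := by
  simp [ofCoords, add_smul, Finset.sum_add_distrib]

theorem ofCoords_neg (m : Fin 4 → ℤ) : ofCoords (-m) = -ofCoords m := by
  simp [ofCoords]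

theorem ofCoords_sub (m m' : Fin 4 → ℤ) : ofCoords (m - m') = ofCoords m - ofCoords m' := by
  simp [sub_eq_add_neg, ofCoords_add, ofCoords_neg]

theorem le'_ofCoords {m m' : Fin 4 → ℤ} :
    le' (ofCoords m) (ofCoords m') ↔ ∀ i, m i ≤ m' i := by
  rw [le', ← ofCoords_sub]
  constructor
  · rintro ⟨c, hc⟩ i
    have h : ofCoords (m' - m) = ofCoords (fun i ↦ (c i : ℤ)) := by simpa [ofCoords] using hc
    have := congrFun (ofCoords_injective h) i
    simp only [Pi.sub_apply] at this
    omega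
  · intro h
    refine ⟨fun i ↦ (m' i - m i).toNat, Finset.sum_congr rfl fun i _ ↦ ?_⟩
    have : (((m' i - m i).toNat : ℤ) : ℝ) = ((m' i - m i : ℤ) : ℝ) := by
      rw [Int.toNat_of_nonneg (sub_nonneg.2 (h i))]
    rw [Int.cast_natCast] at this
    rw [this]
    rfl

/-- The coordinates of `e i` with respect to `φ₁, …, φ₄`. -/
def eCoords : Fin 4 → Fin 4 → ℤ := ![![1, 2, 3, 2], ![1, 1, 1, 0], ![0, 1, 1, 0], ![0, 0, 1, 0]]

theorem ofCoords_eCoords (i : Fin 4) : ofCoords (eCoords i) = e i := by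
  ext j
  fin_cases i <;> fin_cases j <;>
    simp [eCoords, e, ofCoords_apply_zero, ofCoords_apply_one, ofCoords_apply_two,
      ofCoords_apply_three]
  all_goals norm_num

/-- The coordinates of `(±e₁ ± e₂ ± e₃ ± e₄) / 2`, the sign of `e i` being `+` where `t i`. -/
def halfCoords (t : Fin 4 → Bool) : Fin 4 → ℤ :=
  ∑ i, (if t i then eCoords i else 0) - ![1, 2, 3, 1]

theorem ofCoords_halfCoords (t : Fin 4 → Bool) :
    ofCoords (halfCoords t) = (1 / 2 : ℝ) • ∑ i, (if t i then 1 else -1 : ℝ) • e i := by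
  ext j
  rcases h0 : t 0 <;> rcases h1 : t 1 <;> rcases h2 : t 2 <;> rcases h3 : t 3 <;>
    fin_cases j <;>
    simp [halfCoords, eCoords, e, h0, h1, h2, h3, ofCoords_apply_zero, ofCoords_apply_one,
      ofCoords_apply_two, ofCoords_apply_three, Fin.sum_univ_four] <;> norm_num

/-- A property of integer coordinates that holds for those of every root in the three families
defining `Δ` holds for every root. -/
theorem exists_coords_of_mem_Δ {P : (Fin 4 → ℤ) → Prop}
    (short : ∀ i, P (eCoords i) ∧ P (-eCoords i))
    (long : ∀ i j, i < j → P (eCoords i + eCoords j) ∧ P (eCoords i - eCoords j) ∧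
      P (-eCoords i + eCoords j) ∧ P (-eCoords i - eCoords j))
    (half : ∀ t, P (halfCoords t)) {α : V} (hα : α ∈ Δ) : ∃ m, P m ∧ α = ofCoords m := by
  rcases hα with (hα | hα) | ⟨s, hs, rfl⟩
  · simp only [Set.mem_iUnion, Set.mem_insert_iff, Set.mem_singleton_iff] at hα
    obtain ⟨i, rfl | rfl⟩ := hα
    · exact ⟨_, (short i).1, (ofCoords_eCoords i).symm⟩
    · exact ⟨_, (short i).2, by rw [ofCoords_neg, ofCoords_eCoords]⟩
  · simp only [Set.mem_iUnion, Set.mem_insert_iff, Set.mem_singleton_iff] at hα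
    obtain ⟨i, j, hij, rfl | rfl | rfl | rfl⟩ := hα
    · exact ⟨_, (long i j hij).1, by simp [ofCoords_add, ofCoords_eCoords]⟩
    · exact ⟨_, (long i j hij).2.1, by simp [ofCoords_sub, ofCoords_eCoords]⟩
    · exact ⟨_, (long i j hij).2.2.1, by simp [ofCoords_add, ofCoords_neg, ofCoords_eCoords]⟩
    · exact ⟨_, (long i j hij).2.2.2, by simp [ofCoords_sub, ofCoords_neg, ofCoords_eCoords]⟩
  · classical
    refine ⟨_, half fun i ↦ decide (s i = 1), ?_⟩
    rw [ofCoords_halfCoords]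
    congr 1
    refine Finset.sum_congr rfl fun i _ ↦ ?_
    rcases hs i with h | h <;> norm_num [h]

theorem neg_mem_Δ {α : V} (hα : α ∈ Δ) : -α ∈ Δ := by
  rcases hα with (hα | hα) | ⟨s, hs, rfl⟩
  · simp only [Set.mem_iUnion, Set.mem_insert_iff, Set.mem_singleton_iff] at hα
    obtain ⟨i, hα⟩ := hα
    refine Or.inl (Or.inl (Set.mem_iUnion.2 ⟨i, ?_⟩))
    rcases hα with rfl | rfl <;> simp
  · simp only [Set.mem_iUnion, Set.mem_insert_iff, Set.mem_singleton_iff] at hα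
    obtain ⟨i, j, hij, hα⟩ := hα
    refine Or.inl (Or.inr (Set.mem_iUnion₂.2 ⟨i, j, Set.mem_iUnion.2 ⟨hij, ?_⟩⟩))
    rcases hα with rfl | rfl | rfl | rfl
    · exact Or.inr (Or.inr (Or.inr (neg_add' _ _)))
    · exact Or.inr (Or.inr (Or.inl (by abel)))
    · exact Or.inr (Or.inl (by abel))
    · exact Or.inl (by abel)
  · refine Or.inr ⟨-s, fun i ↦ ?_, by simp⟩
    rcases hs i with h | h <;> simp [h]

/-- The four roots of the base of `stmt8`, as a family. -/
def newBase : Fin 4 → V :=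
  ![φ₁ + φ₂ + (2 : ℝ) • φ₃, φ₁ + φ₂ + φ₃ + φ₄, -(φ₁ + φ₂ + φ₃), φ₂]

theorem linearIndependent_newBase : LinearIndependent ℝ newBase := by
  refine Fintype.linearIndependent_iff.2 fun g hg ↦ ?_
  have h0 := congrFun hg 0
  have h1 := congrFun hg 1
  have h2 := congrFun hg 2
  have h3 := congrFun hg 3
  simp [newBase, φ₁, φ₂, φ₃, φ₄, e, Fin.sum_univ_four] at h0 h1 h2 h3
  intro i
  fin_cases i <;> simp <;> linarith

theorem newBase_mem_Δ (i : Fin 4) : newBase i ∈ Δ := by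
  fin_cases i
  · refine Or.inl (Or.inr (Set.mem_iUnion₂.2 ⟨1, 3, Set.mem_iUnion.2 ⟨by decide, Or.inl ?_⟩⟩))
    simp only [newBase, φ₁, φ₂, φ₃, two_smul, Fin.zero_eta, Matrix.cons_val_zero]
    abel
  · refine Or.inr ⟨![1, 1, -1, -1], fun i ↦ by fin_cases i <;> simp, ?_⟩
    ext j
    fin_cases j <;> simp [newBase, φ₁, φ₂, φ₃, φ₄, e, Fin.sum_univ_four]
    norm_num
  · refine Or.inl (Or.inl (Set.mem_iUnion.2 ⟨1, Or.inr ?_⟩))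
    simp [newBase, φ₁, φ₂, φ₃]
  · refine Or.inl (Or.inr (Set.mem_iUnion₂.2
      ⟨2, 3, Set.mem_iUnion.2 ⟨by decide, Or.inr (Or.inl ?_)⟩⟩))
    simp [newBase, φ₂]

/-- The coordinates with respect to `newBase` of the vector with `φ`-coordinates `m`. -/
def newCoords (m : Fin 4 → ℤ) : Fin 4 → ℤ :=
  ![m 2 - m 0, m 3, m 2 + m 3 - 2 * m 0, m 1 - m 0]

theorem sum_newCoords (m : Fin 4 → ℤ) : ∑ i, (newCoords m i : ℝ) • newBase i = ofCoords m := by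
  ext j
  fin_cases j <;>
    simp [newCoords, newBase, ofCoords, φv, φ₁, φ₂, φ₃, φ₄, e, Fin.sum_univ_four] <;> ring

theorem coe_image_newBase :
    ({φ₁ + φ₂ + (2 : ℝ) • φ₃, φ₁ + φ₂ + φ₃ + φ₄, -(φ₁ + φ₂ + φ₃), φ₂} : Finset V) =
      Finset.univ.image newBase := by
  ext x
  simp [newBase, Fin.exists_fin_succ, eq_comm]

theorem sum_image_newBase (c : V → ℤ) :
    ∑ x ∈ Finset.univ.image newBase, (c x : ℝ) • x =
      ∑ i, (c (newBase i) : ℝ) • newBase i :=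
  Finset.sum_image fun _ _ _ _ h ↦ linearIndependent_newBase.injective h

theorem exists_extension_newCoords (m : Fin 4 → ℤ) :
    ∃ c : V → ℤ, (∀ i, c (newBase i) = newCoords m i) ∧
      ofCoords m = ∑ x ∈ Finset.univ.image newBase, (c x : ℝ) • x := by
  have hc := linearIndependent_newBase.injective.extend_apply (newCoords m) 0
  exact ⟨_, hc, by simp only [sum_image_newBase, hc, sum_newCoords]⟩

theorem ofCoords_mem_posOf {m : Fin 4 → ℤ} (hm : ofCoords m ∈ Δ) :
    ofCoords m ∈ posOf (Finset.univ.image newBase) ↔ ∀ i, 0 ≤ newCoords m i := by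
  constructor
  · rintro ⟨-, c, hc, hc0⟩ i
    rw [sum_image_newBase, ← sum_newCoords, ← sub_eq_zero, ← Finset.sum_sub_distrib] at hc
    simp only [← sub_smul] at hc
    have := Fintype.linearIndependent_iff.1 linearIndependent_newBase _ hc i
    rw [sub_eq_zero, Int.cast_inj] at this
    exact this ▸ hc0 _ (Finset.mem_image_of_mem _ (Finset.mem_univ i))
  · intro h
    obtain ⟨c, hc, hsum⟩ := exists_extension_newCoords m
    exact ⟨hm, c, hsum, by simpa [hc] using h⟩

theorem isBase_newBase : IsBase (Finset.univ.image newBase) := by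
  refine ⟨by simpa [Set.range_subset_iff] using newBase_mem_Δ, ?_, fun α hα ↦ ?_⟩
  · have := linearIndependent_newBase.linearIndepOn_id
    rw [← Set.image_univ, ← Finset.coe_univ, ← Finset.coe_image] at this
    exact this
  · obtain ⟨m, hm, rfl⟩ := exists_coords_of_mem_Δ
      (P := fun m ↦ (∀ i, 0 ≤ newCoords m i) ∨ ∀ i, newCoords m i ≤ 0)
      (by decide) (by decide) (by decide) hα
    obtain ⟨c, hc, hsum⟩ := exists_extension_newCoords m
    exact ⟨c, hsum, by simpa [hc] using hm⟩

theorem ofCoords_mem_Δp {m : Fin 4 → ℤ} (hm : ofCoords m ∈ Δ) :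
    ofCoords m ∈ Δp ↔ ∀ i, 0 ≤ m i := by
  simp [Δp, hm, n_ofCoords]

theorem ofCoords_mem_Δkp {m : Fin 4 → ℤ} (hm : ofCoords m ∈ Δ) :
    ofCoords m ∈ Δkp ↔ (∀ i, 0 ≤ m i) ∧ m 0 % 2 = 0 := by
  rw [Δkp, Set.mem_inter_iff, ofCoords_mem_Δp hm, Δk, Set.mem_sep_iff, and_iff_right hm, n_ofCoords,
    ← Int.even_iff, even_iff_exists_two_mul]
  norm_cast

theorem ofCoords_mem_Δnp {m : Fin 4 → ℤ} (hm : ofCoords m ∈ Δ) :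
    ofCoords m ∈ Δnp ↔ (∀ i, 0 ≤ m i) ∧ m 0 % 2 = 1 := by
  rw [Δnp, Set.mem_inter_iff, ofCoords_mem_Δp hm, Δn, Set.mem_sep_iff, and_iff_right hm, n_ofCoords,
    ← Int.odd_iff, Odd]
  norm_cast

theorem posOf_newBase :
    posOf (Finset.univ.image newBase) =
      Δkp ∪ {β ∈ Δnp | le' (φ₁ + φ₂ + (2 : ℝ) • φ₃) β ∨ le' (φ₁ + φ₂ + φ₃ + φ₄) β} ∪
        (Neg.neg '' {β ∈ Δnp | le' β (φ₁ + φ₂ + φ₃)}) := by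
  have h₁ : φ₁ + φ₂ + (2 : ℝ) • φ₃ = ofCoords ![1, 1, 2, 0] := by
    simp [ofCoords, φv, Fin.sum_univ_four]
  have h₂ : φ₁ + φ₂ + φ₃ + φ₄ = ofCoords ![1, 1, 1, 1] := by
    simp [ofCoords, φv, Fin.sum_univ_four]
  have h₃ : φ₁ + φ₂ + φ₃ = ofCoords ![1, 1, 1, 0] := by
    simp [ofCoords, φv, Fin.sum_univ_four]
  ext α
  by_cases hα : α ∈ Δ
  · obtain ⟨m, hm, rfl⟩ := exists_coords_of_mem_Δ
      (P := fun m ↦ (∀ i, 0 ≤ newCoords m i) ↔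
        (((∀ i, 0 ≤ m i) ∧ m 0 % 2 = 0) ∨ (((∀ i, 0 ≤ m i) ∧ m 0 % 2 = 1) ∧
          ((∀ i, (![1, 1, 2, 0] : Fin 4 → ℤ) i ≤ m i) ∨
            ∀ i, (![1, 1, 1, 1] : Fin 4 → ℤ) i ≤ m i))) ∨
        (((∀ i, 0 ≤ (-m) i) ∧ (-m) 0 % 2 = 1) ∧
          ∀ i, (-m) i ≤ (![1, 1, 1, 0] : Fin 4 → ℤ) i))
      (by decide) (by decide) (by decide) hα
    have hneg : ofCoords (-m) ∈ Δ := ofCoords_neg m ▸ neg_mem_Δ hα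
    rw [h₂, h₁, h₃, ofCoords_mem_posOf hα, hm, Set.image_neg_eq_neg, Set.mem_union, Set.mem_union,
      Set.mem_neg, ← ofCoords_neg, Set.mem_sep_iff, Set.mem_sep_iff, ofCoords_mem_Δkp hα,
      ofCoords_mem_Δnp hα, ofCoords_mem_Δnp hneg, le'_ofCoords, le'_ofCoords, le'_ofCoords]
  · refine iff_of_false (fun h ↦ hα h.1) ?_
    rintro ((h | h) | ⟨β, h, rfl⟩)
    · exact hα h.1.1
    · exact hα h.1.1.1
    · exact hα (neg_mem_Δ h.1.1.1)

theorem stmt8 :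
    IsBase ({φ₁ + φ₂ + (2 : ℝ) • φ₃, φ₁ + φ₂ + φ₃ + φ₄, -(φ₁ + φ₂ + φ₃), φ₂} : Finset V) ∧
    posOf ({φ₁ + φ₂ + (2 : ℝ) • φ₃, φ₁ + φ₂ + φ₃ + φ₄, -(φ₁ + φ₂ + φ₃), φ₂} : Finset V) =
      Δkp ∪ {β ∈ Δnp | le' (φ₁ + φ₂ + (2 : ℝ) • φ₃) β ∨ le' (φ₁ + φ₂ + φ₃ + φ₄) β} ∪ (Neg.neg '' {β ∈ Δnp | le' β (φ₁ + φ₂ + φ₃)}) ∧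
    Δkp ⊆ posOf ({φ₁ + φ₂ + (2 : ℝ) • φ₃, φ₁ + φ₂ + φ₃ + φ₄, -(φ₁ + φ₂ + φ₃), φ₂} : Finset V) := by
  rw [coe_image_newBase]
  refine ⟨isBase_newBase, posOf_newBase, ?_⟩
  rw [posOf_newBase]
  exact fun _ h ↦ Or.inl (Or.inl h)
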